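/- arXiv:1203.1014 — 2 statements merged into one kernel-verified Lean document; each statement's English description precedes it below -/
import Mathlib

section
/- Let G be a finite connected simple graph possessing k pairwise edge-disjoint spanning trees, and let D be a minimal disconnecting edge set of G with |D| = k. Then for every vertex v of G, the induced subgraph of G on the vertex set of the connected component of v in the graph G with the edges of D deleted has k pairwise edge-disjoint spanning trees. -/
open Set

namespace MaxSTP

variable {W : Type*}

/-- `T` is a spanning tree of `G`: a spanning subgraph of `G` (on the same vertex
set) that is a tree. -/
def IsSpanningTreeOf (G T : SimpleGraph W) : Prop := T ≤ G ∧ T.IsTree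

/-- `G` has `k` pairwise edge-disjoint spanning trees. -/
def HasDisjointSpanningTrees (G : SimpleGraph W) (k : ℕ) : Prop :=
  ∃ T : Fin k → SimpleGraph W, (∀ i, IsSpanningTreeOf G (T i)) ∧
    Pairwise (Function.onFun Disjoint fun i => (T i).edgeSet)

/-- `D` is a disconnecting edge set of `G`: a set of edges of `G` whose deletion
leaves a graph that is not connected. -/
def IsDisconnectingSet (G : SimpleGraph W) (D : Set (Sym2 W)) : Prop :=
  D ⊆ G.edgeSet ∧ ¬ (G.deleteEdges D).Connected

end MaxSTP

namespace MaxSTP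

/-- A disconnecting set meets every spanning tree. -/
theorem IsDisconnectingSet.exists_mem_edgeSet {V : Type*} {G T : SimpleGraph V}
    {D : Set (Sym2 V)} (hD : IsDisconnectingSet G D) (hT : IsSpanningTreeOf G T) :
    ∃ e ∈ D, e ∈ T.edgeSet := by
  by_contra! h
  refine hD.2 (hT.2.connected.mono fun a b hab => ?_)
  rw [SimpleGraph.deleteEdges_adj]
  exact ⟨hT.1 hab, fun hmem => h _ hmem hab⟩

/-- If `k` disjoint sets all meet a set of `k` elements, each meets it in exactly one element. -/
theorem subsingleton_inter_of_ncard_eq {α : Type*} {k : ℕ} {D : Set α} (hfin : D.Finite)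
    (hDk : D.ncard = k) {E : Fin k → Set α} (hE : Pairwise (Function.onFun Disjoint E))
    (hmeet : ∀ i, ∃ e ∈ D, e ∈ E i) (i : Fin k) : (D ∩ E i).Subsingleton := by
  choose f hfD hfE using hmeet
  have huniq {i j : Fin k} {x : α} (hi : x ∈ E i) (hj : x ∈ E j) : i = j := by
    by_contra hij
    exact Set.disjoint_left.1 (hE hij) hi hj
  have hinj : Function.Injective f := fun a b hab => huniq (hfE a) (hab ▸ hfE b)
  have hrange : Set.range f = D := by
    refine Set.eq_of_subset_of_ncard_le (Set.range_subset_iff.2 hfD) ?_ hfin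
    rw [← Set.image_univ, Set.ncard_image_of_injective _ hinj, Set.ncard_univ, hDk]
    simp
  have key : ∀ x ∈ D ∩ E i, x = f i := by
    rintro x ⟨hxD, hxE⟩
    obtain ⟨j, rfl⟩ := hrange.symm ▸ hxD
    rw [huniq hxE (hfE j)]
  exact fun x hx y hy => (key x hx).trans (key y hy).symm

/-- A tree with at most one edge leaving a nonempty set `S` induces a tree on `S`. -/
theorem isTree_induce_of_boundary_subsingleton {V : Type*} {T : SimpleGraph V} (hT : T.IsTree)
    {S : Set V} (hS : S.Nonempty)
    (hb : {e | ∃ a b, T.Adj a b ∧ a ∈ S ∧ b ∉ S ∧ e = s(a, b)}.Subsingleton) :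
    (T.induce S).IsTree := by
  classical
  have hne : Nonempty S := hS.to_subtype
  refine ⟨⟨?_⟩, hT.isAcyclic.induce S⟩
  rintro ⟨a, ha⟩ ⟨b, hb'⟩
  obtain ⟨p, hp⟩ := hT.connected.exists_isPath a b
  have hsupp : ∀ u ∈ p.support, u ∈ S := by
    intro u hu
    by_contra huS
    obtain ⟨d, hd, hd1, hd2⟩ := (p.takeUntil u hu).exists_boundary_dart S ha huS
    obtain ⟨d', hd', hd1', hd2'⟩ :=
      (p.dropUntil u hu).exists_boundary_dart Sᶜ huS (by simpa using hb')
    have heq : d.edge = d'.edge :=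
      hb ⟨d.fst, d.snd, d.adj, hd1, hd2, rfl⟩
        ⟨d'.snd, d'.fst, d'.adj.symm, not_not.1 hd2', hd1', Sym2.eq_swap⟩
    have hnodup := hp.isTrail.edges_nodup
    rw [← p.take_spec hu, SimpleGraph.Walk.edges_append] at hnodup
    exact List.disjoint_of_nodup_append hnodup (List.mem_map_of_mem hd)
      (heq ▸ List.mem_map_of_mem hd')
  exact (p.induce S hsupp).reachable

end MaxSTP

/-- Let `G` be a finite connected simple graph with `k` pairwise edge-disjoint
spanning trees, and let `D` be a minimal disconnecting edge set of `G` with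
`|D| = k`.  Then for every vertex `v`, the subgraph of `G` induced on the vertex
set of the connected component of `v` in `G` with the edges of `D` deleted has
`k` pairwise edge-disjoint spanning trees. -/
theorem components_after_min_cut_deletion {V : Type*} [Fintype V]
    (G : SimpleGraph V) (hG : G.Connected) (k : ℕ)
    (htrees : MaxSTP.HasDisjointSpanningTrees G k)
    (D : Set (Sym2 V))
    (hD : Minimal (MaxSTP.IsDisconnectingSet G) D)
    (hDk : D.ncard = k) (v : V) :
    MaxSTP.HasDisjointSpanningTrees
      (G.induce {w | (G.deleteEdges D).Reachable v w}) k := by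
  obtain ⟨T, hT, hdisj⟩ := htrees
  have hone := MaxSTP.subsingleton_inter_of_ncard_eq D.toFinite hDk hdisj
    fun i => hD.prop.exists_mem_edgeSet (hT i)
  refine ⟨fun i => (T i).induce {w | (G.deleteEdges D).Reachable v w}, fun i =>
    ⟨SimpleGraph.comap_monotone _ (hT i).1, ?_⟩, fun i j hij => ?_⟩
  · refine MaxSTP.isTree_induce_of_boundary_subsingleton (hT i).2
      ⟨v, SimpleGraph.Reachable.refl v⟩ ((hone i).anti ?_)
    rintro _ ⟨a, b, hab, ha, hb, rfl⟩
    refine ⟨?_, hab⟩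
    by_contra hmem
    exact hb (SimpleGraph.Reachable.trans ha
      (SimpleGraph.Adj.reachable (SimpleGraph.deleteEdges_adj.2 ⟨(hT i).1 hab, hmem⟩)))
  · refine Set.disjoint_left.2 fun e => ?_
    induction e with
    | _ a b =>
      intro hi hj
      have h : s(a.1, b.1) ∉ (T j).edgeSet := Set.disjoint_left.1 (hdisj hij) hi
      exact h hj
end

section
/- Let G₁ = (V₁, E₁) and G₂ = (V₂, E₂) be finite connected simple graphs on disjoint vertex sets, let k ≥ 1, and suppose that for i = 1, 2 the graph Gᵢ has k pairwise edge-disjoint spanning trees and every disconnecting edge set of Gᵢ has size at least k. Let K be a set of k distinct edges, each joining a vertex of V₁ to a vertex of V₂, and let G = G₁ ∗_K G₂ be the graph with vertex set V₁ ∪ V₂ and edge set E₁ ∪ E₂ ∪ K. Then G is connected, G has k pairwise edge-disjoint spanning trees, every disconnecting edge set of G has size at least k, and K itself is a disconnecting edge set of G of size k; hence σ(G) = λ(G) = k. -/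
open Set

namespace MaxSTP

variable {W : Type*}

/-- The `K`-join `G₁ ∗_K G₂` of graphs `G₁` and `G₂` on disjoint vertex sets
(modelled by the sum type), where `K` is a set of pairs recording edges with one
endpoint in each graph. -/
def kJoin {α β : Type*} (G₁ : SimpleGraph α) (G₂ : SimpleGraph β)
    (K : Finset (α × β)) : SimpleGraph (α ⊕ β) :=
  SimpleGraph.fromEdgeSet
    (Sym2.map Sum.inl '' G₁.edgeSet ∪ Sym2.map Sum.inr '' G₂.edgeSet ∪
      (fun p => s(Sum.inl p.1, Sum.inr p.2)) '' (K : Set (α × β)))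

end MaxSTP

namespace MaxSTP

section KJoin

variable {α β : Type*} {G₁ : SimpleGraph α} {G₂ : SimpleGraph β} {K : Finset (α × β)}

theorem edgeSet_kJoin (G₁ : SimpleGraph α) (G₂ : SimpleGraph β) (K : Finset (α × β)) :
    (kJoin G₁ G₂ K).edgeSet =
      Sym2.map Sum.inl '' G₁.edgeSet ∪ Sym2.map Sum.inr '' G₂.edgeSet ∪
        (fun p => s(Sum.inl p.1, Sum.inr p.2)) '' (K : Set (α × β)) := by
  rw [kJoin, SimpleGraph.edgeSet_fromEdgeSet, sdiff_eq_left, Set.disjoint_left]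
  rintro e ((⟨e, he, rfl⟩ | ⟨e, he, rfl⟩) | ⟨p, -, rfl⟩)
  · induction e with
    | _ a b => simpa using SimpleGraph.Adj.ne he
  · induction e with
    | _ a b => simpa using SimpleGraph.Adj.ne he
  · simp

theorem kJoin_adj_inl {a b : α} :
    (kJoin G₁ G₂ K).Adj (Sum.inl a) (Sum.inl b) ↔ G₁.Adj a b := by
  rw [← SimpleGraph.mem_edgeSet, edgeSet_kJoin]
  have h : s(Sum.inl a, Sum.inl b) = Sym2.map (Sum.inl : α → α ⊕ β) s(a, b) := rfl
  constructor
  · rintro ((⟨e, he, h'⟩ | ⟨e, he, h'⟩) | ⟨p, -, h'⟩)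
    · rw [h] at h'
      rwa [← SimpleGraph.mem_edgeSet, ← Sym2.map.injective Sum.inl_injective h']
    · induction e with
      | _ a b => simp at h'
    · simp at h'
  · exact fun hab => .inl (.inl ⟨s(a, b), hab, rfl⟩)

theorem kJoin_adj_inr {a b : β} :
    (kJoin G₁ G₂ K).Adj (Sum.inr a) (Sum.inr b) ↔ G₂.Adj a b := by
  rw [← SimpleGraph.mem_edgeSet, edgeSet_kJoin]
  have h : s(Sum.inr a, Sum.inr b) = Sym2.map (Sum.inr : β → α ⊕ β) s(a, b) := rfl
  constructor
  · rintro ((⟨e, he, h'⟩ | ⟨e, he, h'⟩) | ⟨p, -, h'⟩)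
    · induction e with
      | _ a b => simp at h'
    · rw [h] at h'
      rwa [← SimpleGraph.mem_edgeSet, ← Sym2.map.injective Sum.inr_injective h']
    · simp at h'
  · exact fun hab => .inl (.inr ⟨s(a, b), hab, rfl⟩)

theorem kJoin_adj_inl_inr {a : α} {b : β} :
    (kJoin G₁ G₂ K).Adj (Sum.inl a) (Sum.inr b) ↔ (a, b) ∈ K := by
  rw [← SimpleGraph.mem_edgeSet, edgeSet_kJoin]
  constructor
  · rintro ((⟨e, he, h'⟩ | ⟨e, he, h'⟩) | ⟨⟨c, d⟩, hp, h'⟩)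
    · induction e with
      | _ a b => simp at h'
    · induction e with
      | _ a b => simp at h'
    · simp only [Sym2.eq_iff, Sum.inl.injEq, Sum.inr.injEq, reduceCtorEq, and_self,
        or_false] at h'
      obtain ⟨rfl, rfl⟩ := h'
      exact hp
  · exact fun h => .inr ⟨(a, b), h, rfl⟩

theorem kJoin_mono {T₁ : SimpleGraph α} {T₂ : SimpleGraph β} {L : Finset (α × β)}
    (h₁ : T₁ ≤ G₁) (h₂ : T₂ ≤ G₂) (hL : L ⊆ K) : kJoin T₁ T₂ L ≤ kJoin G₁ G₂ K :=
  SimpleGraph.fromEdgeSet_mono <| by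
    gcongr

theorem connected_kJoin (h₁ : G₁.Connected) (h₂ : G₂.Connected) (hK : K.Nonempty) :
    (kJoin G₁ G₂ K).Connected := by
  obtain ⟨⟨a, b⟩, hab⟩ := hK
  let f₁ : G₁ →g kJoin G₁ G₂ K := ⟨Sum.inl, kJoin_adj_inl.2⟩
  let f₂ : G₂ →g kJoin G₁ G₂ K := ⟨Sum.inr, kJoin_adj_inr.2⟩
  have hadj : (kJoin G₁ G₂ K).Adj (Sum.inl a) (Sum.inr b) := kJoin_adj_inl_inr.2 hab
  rw [SimpleGraph.connected_iff_exists_forall_reachable]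
  refine ⟨Sum.inl a, ?_⟩
  rintro (c | d)
  · exact (h₁.preconnected a c).map f₁
  · exact hadj.reachable.trans ((h₂.preconnected b d).map f₂)

theorem isTree_kJoin_singleton [Finite α] [Finite β] (h₁ : G₁.IsTree) (h₂ : G₂.IsTree)
    (p : α × β) : (kJoin G₁ G₂ {p}).IsTree := by
  have hconn := connected_kJoin h₁.connected h₂.connected (Finset.singleton_nonempty p)
  rw [SimpleGraph.isTree_iff_connected_and_card]
  refine ⟨hconn, le_antisymm ?_ hconn.card_vert_le_card_edgeSet_add_one⟩
  have hc₁ := (SimpleGraph.isTree_iff_connected_and_card.1 h₁).2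
  have hc₂ := (SimpleGraph.isTree_iff_connected_and_card.1 h₂).2
  rw [Nat.card_sum, ← hc₁, ← hc₂]
  simp only [Nat.card_coe_set_eq, edgeSet_kJoin]
  have hi₁ := Set.ncard_image_le (f := Sym2.map (Sum.inl : α → α ⊕ β)) G₁.edgeSet.toFinite
  have hi₂ := Set.ncard_image_le (f := Sym2.map (Sum.inr : β → α ⊕ β)) G₂.edgeSet.toFinite
  grw [Set.ncard_union_le, Set.ncard_union_le, hi₁, hi₂]
  simp
  omega

theorem disjoint_edgeSet_kJoin {H₁ : SimpleGraph α} {H₂ : SimpleGraph β} {L : Finset (α × β)}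
    (h₁ : Disjoint G₁ H₁) (h₂ : Disjoint G₂ H₂) (hKL : Disjoint K L) :
    Disjoint (kJoin G₁ G₂ K).edgeSet (kJoin H₁ H₂ L).edgeSet := by
  rw [SimpleGraph.disjoint_edgeSet, SimpleGraph.disjoint_left]
  rintro (a | a) (b | b)
  · simpa only [kJoin_adj_inl] using SimpleGraph.disjoint_left.1 h₁ a b
  · simpa only [kJoin_adj_inl_inr] using fun h => Finset.disjoint_left.1 hKL h
  · simpa only [SimpleGraph.adj_comm _ (Sum.inr a), kJoin_adj_inl_inr] using
      fun h => Finset.disjoint_left.1 hKL h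
  · simpa only [kJoin_adj_inr] using SimpleGraph.disjoint_left.1 h₂ a b

theorem HasDisjointSpanningTrees.kJoin [Finite α] [Finite β]
    (h₁ : HasDisjointSpanningTrees G₁ K.card) (h₂ : HasDisjointSpanningTrees G₂ K.card) :
    HasDisjointSpanningTrees (kJoin G₁ G₂ K) K.card := by
  obtain ⟨T₁, hT₁, hd₁⟩ := h₁
  obtain ⟨T₂, hT₂, hd₂⟩ := h₂
  refine ⟨fun i => MaxSTP.kJoin (T₁ i) (T₂ i) {(K.equivFin.symm i : α × β)}, fun i => ⟨?_, ?_⟩,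
    fun i j hij => ?_⟩
  · exact kJoin_mono (hT₁ i).1 (hT₂ i).1 (by simp)
  · exact isTree_kJoin_singleton (hT₁ i).2 (hT₂ i).2 _
  · refine disjoint_edgeSet_kJoin (SimpleGraph.disjoint_edgeSet.1 (hd₁ hij))
      (SimpleGraph.disjoint_edgeSet.1 (hd₂ hij)) ?_
    rw [Finset.disjoint_singleton]
    exact fun h => hij (K.equivFin.symm.injective (Subtype.ext h))

theorem isDisconnectingSet_kJoin [Nonempty α] [Nonempty β] :
    IsDisconnectingSet (kJoin G₁ G₂ K)
      ((fun p => s(Sum.inl p.1, Sum.inr p.2)) '' (K : Set (α × β))) := by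
  refine ⟨by rw [edgeSet_kJoin]; exact Set.subset_union_right, fun hconn => ?_⟩
  have hadj : ∀ u v, ((kJoin G₁ G₂ K).deleteEdges
      ((fun p => s(Sum.inl p.1, Sum.inr p.2)) '' (K : Set (α × β)))).Adj u v →
      u.isLeft = v.isLeft := by
    rintro (a | a) (b | b) h
    · rfl
    · rw [SimpleGraph.deleteEdges_adj, kJoin_adj_inl_inr] at h
      exact absurd ⟨(a, b), h.1, rfl⟩ h.2
    · rw [SimpleGraph.adj_comm, SimpleGraph.deleteEdges_adj, kJoin_adj_inl_inr] at h
      exact absurd ⟨(b, a), h.1, rfl⟩ h.2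
    · rfl
  obtain ⟨a⟩ := ‹Nonempty α›
  obtain ⟨b⟩ := ‹Nonempty β›
  obtain ⟨w⟩ := hconn.preconnected (Sum.inl a) (Sum.inr b)
  have key : ∀ {u v}, ((kJoin G₁ G₂ K).deleteEdges
      ((fun p => s(Sum.inl p.1, Sum.inr p.2)) '' (K : Set (α × β)))).Walk u v →
      u.isLeft = v.isLeft := by
    intro u v w
    induction w with
    | nil => rfl
    | cons h _ ih => exact (hadj _ _ h).trans ih
  simpa using key w

end KJoin

theorem HasDisjointSpanningTrees.le_ncard [Finite W] {G : SimpleGraph W} {k : ℕ}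
    (h : HasDisjointSpanningTrees G k) {D : Set (Sym2 W)} (hD : IsDisconnectingSet G D) :
    k ≤ D.ncard := by
  obtain ⟨T, hT, hd⟩ := h
  have hmeet : ∀ i, ∃ e ∈ D, e ∈ (T i).edgeSet := by
    intro i
    by_contra! hi
    exact hD.2 <| (hT i).2.connected.mono fun u v huv =>
      SimpleGraph.deleteEdges_adj.2 ⟨(hT i).1 huv, fun he => hi _ he huv⟩
  choose e heD heT using hmeet
  have hinj : Function.Injective fun i => (⟨e i, heD i⟩ : D) := by
    intro i j hij
    by_contra hne
    have heq : e i = e j := congrArg Subtype.val hij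
    exact Set.disjoint_left.1 (hd hne) (heT i) (by rw [heq]; exact heT j)
  simpa [Nat.card_coe_set_eq] using Nat.card_le_card_of_injective _ hinj

end MaxSTP

/-- Let `G₁, G₂` be finite connected simple graphs on disjoint vertex sets, each
having `k ≥ 1` pairwise edge-disjoint spanning trees and every disconnecting
edge set of size at least `k`, and let `K` be a set of `k` distinct edges
joining a vertex of `G₁` to a vertex of `G₂`.  Then the `K`-join
`G = G₁ ∗_K G₂` is connected, has `k` pairwise edge-disjoint spanning trees,
every disconnecting edge set of `G` has size at least `k`, and `K` itself is a
disconnecting edge set of `G` of size `k`; hence `σ(G) = λ(G) = k`. -/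
theorem kJoin_max_stp {α β : Type*} [Fintype α] [Fintype β]
    (G₁ : SimpleGraph α) (G₂ : SimpleGraph β)
    (h₁ : G₁.Connected) (h₂ : G₂.Connected) (k : ℕ) (hk : 1 ≤ k)
    (ht₁ : MaxSTP.HasDisjointSpanningTrees G₁ k)
    (ht₂ : MaxSTP.HasDisjointSpanningTrees G₂ k)
    (hc₁ : ∀ D, MaxSTP.IsDisconnectingSet G₁ D → k ≤ D.ncard)
    (hc₂ : ∀ D, MaxSTP.IsDisconnectingSet G₂ D → k ≤ D.ncard)
    (K : Finset (α × β)) (hK : K.card = k) :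
    (MaxSTP.kJoin G₁ G₂ K).Connected ∧
    MaxSTP.HasDisjointSpanningTrees (MaxSTP.kJoin G₁ G₂ K) k ∧
    (∀ D, MaxSTP.IsDisconnectingSet (MaxSTP.kJoin G₁ G₂ K) D → k ≤ D.ncard) ∧
    (MaxSTP.IsDisconnectingSet (MaxSTP.kJoin G₁ G₂ K)
        ((fun p => s(Sum.inl p.1, Sum.inr p.2)) '' (K : Set (α × β))) ∧
      ((fun p => s(Sum.inl p.1, Sum.inr p.2)) '' (K : Set (α × β))).ncard = k) := by
  subst hK
  have htrees := ht₁.kJoin ht₂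
  have := h₁.nonempty
  have := h₂.nonempty
  refine ⟨MaxSTP.connected_kJoin h₁ h₂ (Finset.card_pos.1 hk), htrees,
    fun D hD => htrees.le_ncard hD, MaxSTP.isDisconnectingSet_kJoin, ?_⟩
  rw [Set.ncard_image_of_injective _ fun p q hpq => by simpa [Prod.ext_iff] using hpq,
    Set.ncard_coe_finset]
end
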